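/- Let K be an algebraically closed field of prime characteristic p, let d ≥ 2 be an integer not divisible by p, and let n > d be a power of p. Then there do not exist a monic polynomial f ∈ K[X] of degree n with no repeated roots, elements x₀ ≠ x₁ of K, and polynomials v₀, v₁ ∈ K[X] with d·deg(vᵢ) ≤ n − 1 (i = 0,1), such that f(X) = (X − x₀)^n + v₀(X)^d = (X − x₁)^n + v₁(X)^d. -/

import Mathlib

open Polynomial

theorem aux_deg {K : Type*} [Field K] (d : ℕ) (hd : 2 ≤ d) (v w : K[X]) (c : K) (hc : c ≠ 0)
    (h : w ^ d - v ^ d = C c)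
    (hD : v ^ (d - 1) * derivative v = w ^ (d - 1) * derivative w)
    (hw : derivative w ≠ 0) : v.natDegree < w.natDegree := by
  have hcop : IsCoprime (v ^ (d - 1)) (w ^ (d - 1)) := by
    apply IsCoprime.pow
    have h1 : IsCoprime (v ^ d) (w ^ d) := by
      refine ⟨- C c⁻¹, C c⁻¹, ?_⟩
      have : C c⁻¹ * C c = (1 : K[X]) := by
        rw [← C_mul, inv_mul_cancel₀ hc, C_1]
      rw [← this, ← h]; ring
    exact (IsCoprime.pow_iff (by omega) (by omega)).1 h1
  have hdvd : v ^ (d - 1) ∣ derivative w :=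
    hcop.dvd_of_dvd_mul_left (Dvd.intro _ hD)
  have h2 := natDegree_le_of_dvd hdvd hw
  rw [natDegree_pow] at h2
  have h3 : w.natDegree ≠ 0 := by
    intro h0
    rw [eq_C_of_natDegree_eq_zero h0] at hw
    simp at hw
  have h4 := natDegree_derivative_lt h3
  have h5 : 1 * v.natDegree ≤ (d - 1) * v.natDegree := Nat.mul_le_mul_right _ (by omega)
  omega

theorem stmt_9 {K : Type*} [Field K] [IsAlgClosed K] (p : ℕ) (hp : p.Prime)
    [CharP K p] (d n : ℕ) (hd : 2 ≤ d) (hpd : ¬ p ∣ d)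
    (hn : ∃ k : ℕ, n = p ^ k) (hdn : d < n) :
    ¬ ∃ (f : K[X]) (x₀ x₁ : K) (v₀ v₁ : K[X]),
      f.Monic ∧ f.natDegree = n ∧ Squarefree f ∧ x₀ ≠ x₁ ∧
      d * v₀.natDegree ≤ n - 1 ∧ d * v₁.natDegree ≤ n - 1 ∧
      f = (X - C x₀) ^ n + v₀ ^ d ∧ f = (X - C x₁) ^ n + v₁ ^ d := by
  rintro ⟨f, x₀, x₁, v₀, v₁, hm, hdeg, hsq, hne, -, -, h0, h1⟩
  obtain ⟨k, rfl⟩ := hn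
  haveI := Fact.mk hp
  have hk : k ≠ 0 := by
    rintro rfl
    simp at hdn; omega
  have hf' : derivative f ≠ 0 := by
    intro h
    have hs := PerfectField.separable_iff_squarefree.2 hsq
    rw [Polynomial.separable_def, h, isCoprime_zero_right] at hs
    have := natDegree_eq_zero_of_isUnit hs
    omega
  have hd0 : (d : K) ≠ 0 := by rwa [Ne, CharP.cast_eq_zero_iff K p]
  have hp0 : ((p ^ k : ℕ) : K[X]) = 0 := by
    rw [CharP.cast_eq_zero_iff K[X] p]; exact dvd_pow_self p hk
  have hder : ∀ (x : K) (v : K[X]), f = (X - C x) ^ (p ^ k) + v ^ d →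
      derivative f = C (d : K) * (v ^ (d - 1) * derivative v) := by
    intro x v h
    rw [h, derivative_add, derivative_pow, derivative_pow]
    simp [hk, mul_assoc]
  have e0 := hder _ _ h0
  have e1 := hder _ _ h1
  have hD : v₀ ^ (d - 1) * derivative v₀ = v₁ ^ (d - 1) * derivative v₁ :=
    mul_left_cancel₀ (C_ne_zero.2 hd0) (e0.symm.trans e1)
  have hc : v₁ ^ d - v₀ ^ d = C ((x₁ - x₀) ^ (p ^ k)) := by
    have h := h0.symm.trans h1
    rw [sub_pow_char_pow, sub_pow_char_pow] at h
    rw [sub_pow_char_pow, C_sub, C_pow, C_pow]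
    linear_combination -h
  have hc0 : (x₁ - x₀) ^ (p ^ k) ≠ 0 := pow_ne_zero _ (sub_ne_zero.2 hne.symm)
  have a := aux_deg d hd v₀ v₁ _ hc0 hc hD (by intro h; apply hf'; rw [e1, h]; simp)
  have b := aux_deg d hd v₁ v₀ _ (neg_ne_zero.2 hc0) (by rw [C_neg, ← hc]; ring) hD.symm
    (by intro h; apply hf'; rw [e0, h]; simp)
  omega
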